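/- There is a well-defined group homomorphism cor : H¹(N, M) → H¹(G, M) such that for every 1-cocycle z on N and every section s : G/N → G, cor sends the cohomology class of z to the cohomology class of the transfer cor_s(z); in particular the class of cor_s(z) depends neither on the choice of section s nor on the choice of representative z within its cohomology class. -/

import Mathlib

open scoped BigOperators

section H1

variable (W : Type*) [Group W]

/-- The abelian group of 1-cocycles `W → M`. -/
def cocycles (M : Type*) [AddCommGroup M] [DistribMulAction W M] :
    AddSubgroup (W → M) where
  carrier := {z | ∀ w₁ w₂ : W, z (w₁ * w₂) = z w₁ + w₁ • z w₂}
  zero_mem' := by intro w₁ w₂; simp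
  add_mem' := by
    intro a b ha hb w₁ w₂
    simp only [Pi.add_apply, ha w₁ w₂, hb w₁ w₂, smul_add]
    abel
  neg_mem' := by
    intro a ha w₁ w₂
    simp only [Pi.neg_apply, ha w₁ w₂, smul_neg, neg_add]

/-- The abelian group of 1-coboundaries `W → M`. -/
def coboundaries (M : Type*) [AddCommGroup M] [DistribMulAction W M] :
    AddSubgroup (W → M) where
  carrier := {z | ∃ m : M, ∀ w : W, z w = w • m - m}
  zero_mem' := ⟨0, by simp⟩
  add_mem' := by
    rintro a b ⟨m, hm⟩ ⟨m', hm'⟩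
    refine ⟨m + m', fun w => ?_⟩
    simp only [Pi.add_apply, hm w, hm' w, smul_add]
    abel
  neg_mem' := by
    rintro a ⟨m, hm⟩
    refine ⟨-m, fun w => ?_⟩
    simp only [Pi.neg_apply, hm w, smul_neg]
    abel

/-- First group cohomology `H¹(W, M)`: 1-cocycles modulo 1-coboundaries. -/
def H1 (M : Type*) [AddCommGroup M] [DistribMulAction W M] :=
  cocycles W M ⧸ ((coboundaries W M).addSubgroupOf (cocycles W M))

instance (M : Type*) [AddCommGroup M] [DistribMulAction W M] : AddCommGroup (H1 W M) :=
  QuotientAddGroup.Quotient.addCommGroup _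

end H1

variable {G : Type*} [Group G] {M : Type*} [AddCommGroup M] [DistribMulAction G M]

/-- A 1-cocycle on a subgroup `H` of `G` (for the restricted action). -/
def IsCocycleOn (H : Subgroup G) (z : H → M) : Prop :=
  ∀ h₁ h₂ : H, z (h₁ * h₂) = z h₁ + (h₁ : G) • z h₂

/-- A 1-cocycle on `G`. -/
def IsCocycle (z : G → M) : Prop :=
  ∀ w₁ w₂ : G, z (w₁ * w₂) = z w₁ + w₁ • z w₂

/-- The element `s(γ)⁻¹ ⬝ w ⬝ s(w⁻¹γ)` lies in the normal subgroup `N`,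
provided `s` is a section of the projection `G → G ⧸ N`. -/
lemma transfer_arg_mem (N : Subgroup G) [N.Normal] {s : G ⧸ N → G}
    (hs : ∀ γ : G ⧸ N, (QuotientGroup.mk (s γ) : G ⧸ N) = γ) (w : G) (γ : G ⧸ N) :
    (s γ)⁻¹ * w * s ((QuotientGroup.mk w : G ⧸ N)⁻¹ * γ) ∈ N := by
  rw [← QuotientGroup.eq_one_iff]
  simp only [QuotientGroup.mk_mul, QuotientGroup.mk_inv,
    hs γ, hs ((QuotientGroup.mk w : G ⧸ N)⁻¹ * γ)]
  group

/-- The transfer (corestriction) `cor_s(z) : G → M` of a function `z : N → M`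
along a section `s : G ⧸ N → G`, where `N` is a normal subgroup of finite index. -/
def transfer (N : Subgroup G) [N.Normal] [Fintype (G ⧸ N)] (s : G ⧸ N → G)
    (hs : ∀ γ : G ⧸ N, (QuotientGroup.mk (s γ) : G ⧸ N) = γ) (z : N → M) : G → M :=
  fun w => ∑ γ : G ⧸ N,
    s γ • z ⟨(s γ)⁻¹ * w * s ((QuotientGroup.mk w : G ⧸ N)⁻¹ * γ),
      transfer_arg_mem N hs w γ⟩

section Transfer

variable (N : Subgroup G) [N.Normal] [Fintype (G ⧸ N)] {s : G ⧸ N → G}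
  (hs : ∀ γ : G ⧸ N, (QuotientGroup.mk (s γ) : G ⧸ N) = γ)

/-- The transfer of a 1-cocycle is a 1-cocycle. -/
lemma transfer_mem_cocycles {z : N → M} (hz : z ∈ cocycles N M) :
    transfer N s hs z ∈ cocycles G M := by
  intro w₁ w₂
  have hsum : w₁ • transfer N s hs z w₂ = ∑ γ : G ⧸ N, w₁ • s ((QuotientGroup.mk w₁)⁻¹ * γ) •
      z ⟨_, transfer_arg_mem N hs w₂ ((QuotientGroup.mk w₁)⁻¹ * γ)⟩ := by
    rw [transfer, Finset.smul_sum]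
    exact (Equiv.sum_comp (Equiv.mulLeft (QuotientGroup.mk w₁ : G ⧸ N)⁻¹)
      (fun γ => w₁ • s γ • z ⟨_, transfer_arg_mem N hs w₂ γ⟩)).symm
  rw [hsum, transfer, transfer, ← Finset.sum_add_distrib]
  refine Finset.sum_congr rfl fun γ _ => ?_
  have harg : (⟨_, transfer_arg_mem N hs (w₁ * w₂) γ⟩ : N) =
      ⟨_, transfer_arg_mem N hs w₁ γ⟩ *
        ⟨_, transfer_arg_mem N hs w₂ ((QuotientGroup.mk w₁)⁻¹ * γ)⟩ := by
    ext
    simp [mul_assoc]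
  rw [harg, hz, smul_add, Subgroup.smul_def, smul_smul, smul_smul]
  simp [mul_assoc]

/-- The transfer of a 1-coboundary is a 1-coboundary. -/
lemma transfer_mem_coboundaries {z : N → M} (hz : z ∈ coboundaries N M) :
    transfer N s hs z ∈ coboundaries G M := by
  obtain ⟨m, hm⟩ := hz
  refine ⟨∑ γ : G ⧸ N, s γ • m, fun w => ?_⟩
  have hsum : w • ∑ γ : G ⧸ N, s γ • m =
      ∑ γ : G ⧸ N, w • s ((QuotientGroup.mk w)⁻¹ * γ) • m := by
    rw [Finset.smul_sum]
    exact (Equiv.sum_comp (Equiv.mulLeft (QuotientGroup.mk w : G ⧸ N)⁻¹)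
      (fun γ => w • s γ • m)).symm
  rw [hsum, transfer, ← Finset.sum_sub_distrib]
  refine Finset.sum_congr rfl fun γ _ => ?_
  rw [hm, smul_sub, Subgroup.smul_def, smul_smul, smul_smul]
  simp [mul_assoc]

/-- The transfers of a 1-cocycle along two sections differ by a 1-coboundary. -/
lemma transfer_sub_transfer_mem_coboundaries {t : G ⧸ N → G}
    (ht : ∀ γ : G ⧸ N, (QuotientGroup.mk (t γ) : G ⧸ N) = γ)
    {z : N → M} (hz : z ∈ cocycles N M) :
    transfer N t ht z - transfer N s hs z ∈ coboundaries G M := by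
  have hn (γ : G ⧸ N) : (s γ)⁻¹ * t γ ∈ N := QuotientGroup.eq.mp ((hs γ).trans (ht γ).symm)
  refine ⟨∑ γ : G ⧸ N, s γ • z ⟨_, hn γ⟩, fun w => ?_⟩
  have hsum : w • ∑ γ : G ⧸ N, s γ • z ⟨_, hn γ⟩ =
      ∑ γ : G ⧸ N, w • s ((QuotientGroup.mk w)⁻¹ * γ) •
        z ⟨_, hn ((QuotientGroup.mk w)⁻¹ * γ)⟩ := by
    rw [Finset.smul_sum]
    exact (Equiv.sum_comp (Equiv.mulLeft (QuotientGroup.mk w : G ⧸ N)⁻¹)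
      (fun γ => w • s γ • z ⟨_, hn γ⟩)).symm
  rw [hsum, Pi.sub_apply, transfer, transfer, ← Finset.sum_sub_distrib, ← Finset.sum_sub_distrib]
  refine Finset.sum_congr rfl fun γ _ => ?_
  have harg : (⟨_, hn γ⟩ : N) * ⟨_, transfer_arg_mem N ht w γ⟩ =
      ⟨_, transfer_arg_mem N hs w γ⟩ * ⟨_, hn ((QuotientGroup.mk w)⁻¹ * γ)⟩ := by
    ext
    simp [mul_assoc]
  have h := congrArg (s γ • ·) (congrArg z harg)
  simp only [hz _ _, smul_add, Subgroup.smul_def, smul_smul, mul_assoc,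
    mul_inv_cancel_left] at h ⊢
  rw [sub_eq_sub_iff_add_eq_add, add_comm, h, add_comm]

/-- The transfer along a section, as a homomorphism between groups of 1-cocycles. -/
def transferHom : cocycles N M →+ cocycles G M where
  toFun z := ⟨transfer N s hs z, transfer_mem_cocycles N hs z.2⟩
  map_zero' := by
    ext w
    simp [transfer]
  map_add' a b := by
    ext w
    simp [transfer, Finset.sum_add_distrib]

end Transfer

/-- there is a well-defined group homomorphism
`cor : H¹(N, M) → H¹(G, M)` sending, for every 1-cocycle `z` on `N` and every section
`s : G ⧸ N → G`, the cohomology class of `z` to the cohomology class of the transfer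
`cor_s(z)`; in particular the class of `cor_s(z)` depends neither on the choice of the
section `s` nor on the choice of the representative `z` within its cohomology class. -/
theorem corestriction_well_defined (N : Subgroup G) [N.Normal] [Fintype (G ⧸ N)] :
    ∃ cor : H1 N M →+ H1 G M,
      ∀ (z : cocycles N M) (s : G ⧸ N → G)
        (hs : ∀ γ : G ⧸ N, (QuotientGroup.mk (s γ) : G ⧸ N) = γ)
        (hmem : transfer N s hs (z : N → M) ∈ cocycles G M),
        cor (QuotientAddGroup.mk z) =
          QuotientAddGroup.mk (⟨transfer N s hs (z : N → M), hmem⟩ : cocycles G M) := by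
  have hout (γ : G ⧸ N) : (QuotientGroup.mk γ.out : G ⧸ N) = γ := QuotientGroup.out_eq' γ
  refine ⟨QuotientAddGroup.map _ _ (transferHom N hout)
    fun z hz => transfer_mem_coboundaries N hout hz, fun z s hs hmem => ?_⟩
  refine QuotientAddGroup.eq.mpr ?_
  have h := transfer_sub_transfer_mem_coboundaries N hout hs z.2
  rwa [sub_eq_neg_add] at h
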